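/- Let L > 0, B ≥ 0 and let F : ℝ^{m₁×m₂} × ℝ → ℝ^{m₁×m₂} satisfy ‖F(Y,s) − F(Z,t)‖_F ≤ L‖Y−Z‖_F + L|s−t| and ‖F(Y,t)‖_F ≤ B for all Y, Z, s, t. Let 0 ≤ Δt ≤ 1/(2L), let X : ℝ → ℝ^{m₁×m₂} be differentiable with X′(t) = F(X(t),t) on [tⁿ, tⁿ+Δt] and X(tⁿ) = X̂ⁿ. Let Ũ ∈ ℝ^{m₁×s₁}, Ṽ ∈ ℝ^{m₂×s₂} have orthonormal columns with Ũ Ũᵀ X̂ⁿ Ṽ Ṽᵀ = X̂ⁿ and Ũ Ũᵀ F(X̂ⁿ, tⁿ) Ṽ Ṽᵀ = F(X̂ⁿ, tⁿ), and suppose Σ̃ ∈ ℝ^{s₁×s₂} satisfies Σ̃ = Ũᵀ (X̂ⁿ + Δt · F(Ũ Σ̃ Ṽᵀ, tⁿ+Δt)) Ṽ. Then ‖Ũ Σ̃ Ṽᵀ − X(tⁿ + Δt)‖_F ≤ 4 Δt² L (B + 1). -/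

import Mathlib

open Matrix

/-- Frobenius inner product of two real matrices. -/
noncomputable def finner {m₁ m₂ : ℕ} (A B : Matrix (Fin m₁) (Fin m₂) ℝ) : ℝ :=
  ∑ i, ∑ j, A i j * B i j

/-- Frobenius norm of a real matrix. -/
noncomputable def fnorm {m₁ m₂ : ℕ} (A : Matrix (Fin m₁) (Fin m₂) ℝ) : ℝ :=
  Real.sqrt (finner A A)

open scoped Matrix.Norms.Frobenius

theorem fnorm_eq_norm {m n : ℕ} (A : Matrix (Fin m) (Fin n) ℝ) : fnorm A = ‖A‖ := by
  simp [fnorm, finner, frobenius_norm_def, Real.sqrt_eq_rpow, ← pow_two]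

theorem finner_eq_trace {m n : ℕ} (A B : Matrix (Fin m) (Fin n) ℝ) :
    finner A B = (A * Bᵀ).trace := by
  simp [finner, Matrix.trace, Matrix.mul_apply]

theorem finner_sub_self {m n : ℕ} (A B : Matrix (Fin m) (Fin n) ℝ) :
    finner (A - B) (A - B) = finner A A - 2 * finner B A + finner B B := by
  simp only [finner, Matrix.sub_apply, Finset.mul_sum, ← Finset.sum_sub_distrib,
    ← Finset.sum_add_distrib]
  exact Finset.sum_congr rfl fun i _ => Finset.sum_congr rfl fun j _ => by ring

theorem finner_self_nonneg {m n : ℕ} (A : Matrix (Fin m) (Fin n) ℝ) : 0 ≤ finner A A :=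
  Finset.sum_nonneg fun _ _ => Finset.sum_nonneg fun _ _ => mul_self_nonneg _

/-- The two-sided orthogonal projection `M ↦ U Uᵀ M V Vᵀ` is a Frobenius contraction. -/
theorem fnorm_project_le {m₁ m₂ s₁ s₂ : ℕ} {U : Matrix (Fin m₁) (Fin s₁) ℝ}
    {V : Matrix (Fin m₂) (Fin s₂) ℝ} (hU : Uᵀ * U = 1) (hV : Vᵀ * V = 1)
    (M : Matrix (Fin m₁) (Fin m₂) ℝ) : fnorm (U * Uᵀ * M * V * Vᵀ) ≤ fnorm M := by
  set N := U * Uᵀ * M * V * Vᵀ with hN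
  have hUN : U * Uᵀ * N = N := by
    calc U * Uᵀ * N = U * (Uᵀ * U) * Uᵀ * M * V * Vᵀ := by simp only [hN, Matrix.mul_assoc]
      _ = N := by rw [hU, Matrix.mul_one]
  have hNV : N * V * Vᵀ = N := by
    calc N * V * Vᵀ = U * Uᵀ * M * V * (Vᵀ * V) * Vᵀ := by simp only [hN, Matrix.mul_assoc]
      _ = N := by rw [hV, Matrix.mul_one]
  have hinner : finner N N = finner N M := by
    rw [finner_eq_trace, finner_eq_trace]
    calc (N * Nᵀ).trace = ((N * V * Vᵀ) * Mᵀ * (U * Uᵀ)).trace := by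
          congr 1
          simp only [hN, Matrix.transpose_mul, Matrix.transpose_transpose, Matrix.mul_assoc]
      _ = (N * Mᵀ).trace := by
          rw [hNV, Matrix.trace_mul_comm, ← Matrix.mul_assoc, hUN]
  have hnonneg := finner_self_nonneg (M - N)
  rw [finner_sub_self] at hnonneg
  exact Real.sqrt_le_sqrt (by linarith)

theorem hasDerivAt_of_entries {m n : ℕ} {X : ℝ → Matrix (Fin m) (Fin n) ℝ}
    {X' : Matrix (Fin m) (Fin n) ℝ} {t : ℝ}
    (h : ∀ i j, HasDerivAt (fun τ => X τ i j) (X' i j) t) : HasDerivAt X X' t :=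
  hasDerivAt_pi.2 fun i => hasDerivAt_pi.2 fun j => h i j

theorem stmt_9 {m₁ m₂ s₁ s₂ : ℕ} (L B : ℝ) (hL : 0 < L) (hB : 0 ≤ B)
    (F : Matrix (Fin m₁) (Fin m₂) ℝ → ℝ → Matrix (Fin m₁) (Fin m₂) ℝ)
    (hLip : ∀ Y Z s t, fnorm (F Y s - F Z t) ≤ L * fnorm (Y - Z) + L * |s - t|)
    (hbound : ∀ Y t, fnorm (F Y t) ≤ B)
    (tn Δt : ℝ) (hΔt : 0 ≤ Δt) (hΔtL : Δt ≤ 1 / (2 * L))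
    (X : ℝ → Matrix (Fin m₁) (Fin m₂) ℝ)
    (hX : ∀ t ∈ Set.Icc tn (tn + Δt), ∀ i j,
      HasDerivAt (fun τ => X τ i j) (F (X t) t i j) t)
    (Xn : Matrix (Fin m₁) (Fin m₂) ℝ) (hXn : X tn = Xn)
    (U : Matrix (Fin m₁) (Fin s₁) ℝ) (V : Matrix (Fin m₂) (Fin s₂) ℝ)
    (hU : Uᵀ * U = 1) (hV : Vᵀ * V = 1)
    (hXproj : U * Uᵀ * Xn * V * Vᵀ = Xn)
    (hFproj : U * Uᵀ * F Xn tn * V * Vᵀ = F Xn tn)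
    (S : Matrix (Fin s₁) (Fin s₂) ℝ)
    (hfix : S = Uᵀ * (Xn + Δt • F (U * S * Vᵀ) (tn + Δt)) * V) :
    fnorm (U * S * Vᵀ - X (tn + Δt)) ≤ 4 * Δt ^ 2 * L * (B + 1) := by
  simp only [fnorm_eq_norm] at hLip hbound ⊢
  subst hXn
  have hderiv : ∀ t ∈ Set.Icc tn (tn + Δt), HasDerivAt X (F (X t) t) t := fun t ht =>
    hasDerivAt_of_entries (hX t ht)
  have hproj : ∀ M : Matrix (Fin m₁) (Fin m₂) ℝ, ‖U * Uᵀ * M * V * Vᵀ‖ ≤ ‖M‖ := fun M => by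
    simpa only [fnorm_eq_norm] using fnorm_project_le hU hV M
  set Y := U * S * Vᵀ with hY
  have hYeq : Y = X tn + Δt • (U * Uᵀ * F Y (tn + Δt) * V * Vᵀ) := by
    calc Y = U * (Uᵀ * (X tn + Δt • F Y (tn + Δt)) * V) * Vᵀ := by rw [← hfix]
      _ = U * Uᵀ * X tn * V * Vᵀ + Δt • (U * Uᵀ * F Y (tn + Δt) * V * Vᵀ) := by
        simp only [Matrix.mul_add, Matrix.add_mul, Matrix.mul_smul, Matrix.smul_mul,
          Matrix.mul_assoc]
      _ = _ := by rw [hXproj]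
  have hYX : ‖Y - X tn‖ ≤ Δt * B := by
    conv_lhs => rw [hYeq, add_sub_cancel_left, norm_smul, Real.norm_of_nonneg hΔt]
    exact mul_le_mul_of_nonneg_left ((hproj _).trans (hbound _ _)) hΔt
  have hdefect : ‖Y - (X tn + Δt • F (X tn) tn)‖ ≤ Δt * (L * (Δt * B) + L * Δt) := by
    have heq : Y - (X tn + Δt • F (X tn) tn) =
        Δt • (U * Uᵀ * (F Y (tn + Δt) - F (X tn) tn) * V * Vᵀ) := by
      conv_lhs => rw [hYeq]
      simp only [Matrix.mul_sub, Matrix.sub_mul, hFproj, smul_sub]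
      abel
    rw [heq, norm_smul, Real.norm_of_nonneg hΔt]
    have hF := hLip Y (X tn) (tn + Δt) tn
    rw [add_sub_cancel_left, abs_of_nonneg hΔt] at hF
    refine mul_le_mul_of_nonneg_left ((hproj _).trans (hF.trans ?_)) hΔt
    gcongr
  have hXdist : ∀ t ∈ Set.Icc tn (tn + Δt), ‖X t - X tn‖ ≤ B * (t - tn) :=
    norm_image_sub_le_of_norm_deriv_le_segment'
      (fun t ht => (hderiv t ht).hasDerivWithinAt) fun t _ => hbound _ _
  have hlocal := norm_image_sub_le_of_norm_deriv_le_segment'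
    (f := fun t => X t - (t - tn) • F (X tn) tn) (f' := fun t => F (X t) t - F (X tn) tn)
    (C := L * (Δt * B) + L * Δt) (a := tn) (b := tn + Δt)
    (fun t ht => by
      have h := (hderiv t ht).sub
        (((hasDerivAt_id t).sub_const tn).smul_const (F (X tn) tn))
      rw [one_smul] at h
      exact h.hasDerivWithinAt)
    (fun t ht => by
      have h₀ : 0 ≤ t - tn := sub_nonneg.2 ht.1
      have h₁ : t - tn ≤ Δt := by linarith [ht.2]
      have hF := hLip (X t) (X tn) t tn
      rw [abs_of_nonneg h₀] at hF
      refine hF.trans ?_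
      have hdist : ‖X t - X tn‖ ≤ Δt * B := (hXdist t (Set.Ico_subset_Icc_self ht)).trans (by
        rw [mul_comm]
        gcongr)
      gcongr)
    (tn + Δt) ⟨by linarith, le_rfl⟩
  simp only [add_sub_cancel_left, sub_self, zero_smul, sub_zero] at hlocal
  have hsplit : Y - X (tn + Δt) = (Y - (X tn + Δt • F (X tn) tn)) -
      (X (tn + Δt) - Δt • F (X tn) tn - X tn) := by abel
  rw [hsplit]
  have hpos : 0 ≤ Δt ^ 2 * L * (B + 1) := by positivity
  calc _ ≤ _ := norm_sub_le _ _
    _ ≤ _ := add_le_add hdefect hlocal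
    _ = 2 * (Δt ^ 2 * L * (B + 1)) := by ring
    _ ≤ _ := by linarith
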